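/- arXiv:math/0609355 — 3 statements merged into one kernel-verified Lean document; each statement's English description precedes it below -/
import Mathlib

section
/- For δ = 2, 3, 4, 5, 6, 7, 8, the number of conic classes in the del Pezzo lattice of rank 1+δ is, respectively, 2, 3, 5, 10, 27, 126, 2160. -/
/-- A class in the del Pezzo lattice of rank `1 + δ`: the pair `(a, b)`
represents `a·ℓ − b₁e₁ − ⋯ − b_δ e_δ`. -/
abbrev Cls (δ : ℕ) : Type := ℤ × (Fin δ → ℤ)

/-- The intersection product: `(a;b)·(a';b') = a a' − Σ bᵢ bᵢ'`. -/
def ip {δ : ℕ} (x y : Cls δ) : ℤ := x.1 * y.1 - ∑ i, x.2 i * y.2 i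

/-- The canonical class `K = −3ℓ + e₁ + ⋯ + e_δ`, i.e. `(−3; −1, …, −1)`. -/
def Kcls (δ : ℕ) : Cls δ := (-3, fun _ => -1)

/-- A conic class: `Q·Q = 0` and `K·Q = −2`. -/
def IsConic {δ : ℕ} (Q : Cls δ) : Prop := ip Q Q = 0 ∧ ip (Kcls δ) Q = -2

/-- A `(−1)`-class: `L·L = −1` and `K·L = −1`. -/
def IsMinusOne {δ : ℕ} (L : Cls δ) : Prop := ip L L = -1 ∧ ip (Kcls δ) L = -1

/-- Membership in the Weyl group `W_δ`: a ℤ-linear automorphism of the lattice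
preserving the intersection form and fixing the canonical class. -/
def IsWeyl {δ : ℕ} (g : Cls δ ≃ₗ[ℤ] Cls δ) : Prop :=
  (∀ x y : Cls δ, ip (g x) (g y) = ip x y) ∧ g (Kcls δ) = Kcls δ

/-- Vectors of length `n` with entries in `{0, …, 4}` and prescribed sum and sum of squares. -/
def Vecs (n : ℕ) (s q : ℤ) : Type :=
  {b : Fin n → ℤ // (∑ i, b i = s ∧ ∑ i, b i * b i = q) ∧ ∀ i, 0 ≤ b i ∧ b i < 5}

/-- Sum of `f i` for `i < k`. -/
def sumTo (f : ℕ → ℕ) : ℕ → ℕ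
  | 0 => 0
  | k + 1 => sumTo f k + f k

theorem sumTo_eq (f : ℕ → ℕ) (k : ℕ) : sumTo f k = ∑ i : Fin k, f i := by
  induction k with
  | zero => simp [sumTo]
  | succ k ih => simp [sumTo, ih, Fin.sum_univ_castSucc]

/-- Recursive count of `Vecs`, pruned by the Cauchy–Schwarz inequality. -/
def cnt : ℕ → ℤ → ℤ → ℕ
  | 0, s, q => if s = 0 then if q = 0 then 1 else 0 else 0
  | n + 1, s, q =>
    if s * s ≤ ((n + 1 : ℕ) : ℤ) * q then
      sumTo (fun i => cnt n (s - (i : ℤ)) (q - (i : ℤ) * (i : ℤ))) 5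
    else 0

theorem cauchy {n : ℕ} (b : Fin n → ℤ) : (∑ i, b i) * (∑ i, b i) ≤ (n : ℤ) * ∑ i, b i * b i := by
  have h := sq_sum_le_card_mul_sum_sq (s := Finset.univ) (f := b)
  simpa [sq] using h

/-- Splitting off the first coordinate. -/
def splitEquiv (n : ℕ) (s q : ℤ) :
    Vecs (n + 1) s q ≃ Σ i : Fin 5, Vecs n (s - ((i : ℕ) : ℤ))
      (q - ((i : ℕ) : ℤ) * ((i : ℕ) : ℤ)) where
  toFun b :=
    have hb := b.2.2 0
    have e : (((b.1 0).toNat : ℕ) : ℤ) = b.1 0 := by omega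
    ⟨⟨(b.1 0).toNat, by omega⟩, fun i => b.1 i.succ, ⟨by
      have h := b.2.1.1
      rw [Fin.sum_univ_succ] at h
      simp only [e]
      omega, by
      have h := b.2.1.2
      rw [Fin.sum_univ_succ] at h
      simp only [e]
      linarith⟩, fun i => b.2.2 i.succ⟩
  invFun x := ⟨Fin.cons ((x.1 : ℕ) : ℤ) x.2.1, ⟨by
      have h := x.2.2.1.1
      rw [Fin.sum_univ_succ]
      simp only [Fin.cons_zero, Fin.cons_succ]
      linarith, by
      have h := x.2.2.1.2
      rw [Fin.sum_univ_succ]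
      simp only [Fin.cons_zero, Fin.cons_succ]
      linarith⟩, fun i => by
      refine Fin.cases ?_ (fun j => ?_) i
      · simp only [Fin.cons_zero]
        omega
      · simpa only [Fin.cons_succ] using x.2.2.2 j⟩
  left_inv b := by
    have hb := b.2.2 0
    apply Subtype.ext
    funext i
    refine Fin.cases ?_ (fun j => ?_) i
    · simp only [Fin.cons_zero]
      omega
    · simp only [Fin.cons_succ]
  right_inv x := by
    obtain ⟨i, b, h⟩ := x
    rfl

theorem card_vecs (n : ℕ) : ∀ s q : ℤ,
    Finite (Vecs n s q) ∧ Nat.card (Vecs n s q) = cnt n s q := by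
  induction n with
  | zero =>
    intro s q
    have : Subsingleton (Vecs 0 s q) := ⟨fun a b => Subtype.ext (Subsingleton.elim _ _)⟩
    refine ⟨inferInstance, ?_⟩
    by_cases h : s = 0 ∧ q = 0
    · have : Nonempty (Vecs 0 s q) :=
        ⟨⟨fun _ => 0, ⟨by simp [h.1], by simp [h.2]⟩, fun i => i.elim0⟩⟩
      rw [Nat.card_unique, cnt, if_pos h.1, if_pos h.2]
    · have : IsEmpty (Vecs 0 s q) :=
        ⟨fun b => h ⟨by simpa using b.2.1.1.symm, by simpa using b.2.1.2.symm⟩⟩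
      simp only [Nat.card_of_isEmpty, cnt]
      split_ifs <;> simp_all
  | succ n ih =>
    intro s q
    have : ∀ i : Fin 5, Finite (Vecs n (s - ((i : ℕ) : ℤ))
      (q - ((i : ℕ) : ℤ) * ((i : ℕ) : ℤ))) := fun i => (ih _ _).1
    refine ⟨Finite.of_equiv _ (splitEquiv n s q).symm, ?_⟩
    rw [cnt]
    split_ifs with h
    · rw [Nat.card_congr (splitEquiv n s q), Nat.card_sigma, sumTo_eq]
      exact Finset.sum_congr rfl fun i _ => (ih _ _).2
    · have : IsEmpty (Vecs (n + 1) s q) := ⟨fun b => h (by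
        have := cauchy b.1
        rwa [b.2.1.1, b.2.1.2] at this)⟩
      simp

theorem conic_iff {δ : ℕ} (Q : Cls δ) :
    IsConic Q ↔ ∑ i, Q.2 i = 3 * Q.1 - 2 ∧ ∑ i, Q.2 i * Q.2 i = Q.1 * Q.1 := by
  simp only [IsConic, ip, Kcls, neg_mul, one_mul, Finset.sum_neg_distrib]
  constructor <;> rintro ⟨h1, h2⟩ <;> constructor <;> linarith

theorem conic_bound {δ : ℕ} (hδ : δ ≤ 8) (Q : Cls δ) (h : IsConic Q) : 0 ≤ Q.1 ∧ Q.1 < 12 := by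
  rw [conic_iff] at h
  have := cauchy Q.2
  rw [h.1, h.2] at this
  have h8 : (δ : ℤ) ≤ 8 := by exact_mod_cast hδ
  have h9 : (δ : ℤ) * (Q.1 * Q.1) ≤ 8 * (Q.1 * Q.1) :=
    mul_le_mul_of_nonneg_right h8 (mul_self_nonneg _)
  constructor <;> nlinarith

/-- Cauchy–Schwarz on the remaining coordinates bounds each coordinate. -/
theorem conic_coord {δ : ℕ} (hδ : δ ≤ 8) (Q : Cls δ) (h : IsConic Q) (i : Fin δ) :
    0 ≤ Q.2 i ∧ Q.2 i < 5 := by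
  rw [conic_iff] at h
  obtain ⟨a, b⟩ := Q
  obtain ⟨h1, h2⟩ := h
  simp only at h1 h2 ⊢
  rw [← Finset.add_sum_erase _ _ (Finset.mem_univ i)] at h1 h2
  have hc := sq_sum_le_card_mul_sum_sq (s := Finset.univ.erase i) (f := b)
  have hcard : ((Finset.univ.erase i).card : ℤ) ≤ 7 := by
    rw [Finset.card_erase_of_mem (Finset.mem_univ i), Finset.card_univ, Fintype.card_fin]
    omega
  have hnn : 0 ≤ ∑ j ∈ Finset.univ.erase i, b j ^ 2 := Finset.sum_nonneg fun j _ => sq_nonneg _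
  have h3 := hc.trans (mul_le_mul_of_nonneg_right hcard hnn)
  simp only [← sq] at h2
  rw [show ∑ j ∈ Finset.univ.erase i, b j = 3 * a - 2 - b i by linarith,
    show ∑ j ∈ Finset.univ.erase i, b j ^ 2 = a ^ 2 - b i ^ 2 by linarith] at h3
  generalize b i = x at h3
  have h4 : x ^ 2 - 4 * x - 4 ≤ 0 := by nlinarith [sq_nonneg (4 * a - 12 - 6 * x)]
  constructor <;> nlinarith

/-- Conic classes, sorted by degree. -/
def conicEquiv (δ : ℕ) (hδ : δ ≤ 8) : {Q : Cls δ // IsConic Q} ≃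
    Σ a : Fin 12, Vecs δ (3 * ((a : ℕ) : ℤ) - 2) (((a : ℕ) : ℤ) * ((a : ℕ) : ℤ)) where
  toFun Q :=
    have hb := conic_bound hδ Q.1 Q.2
    have e : ((Q.1.1.toNat : ℕ) : ℤ) = Q.1.1 := by omega
    ⟨⟨Q.1.1.toNat, by omega⟩, Q.1.2, by
      simp only [e]
      exact ⟨(conic_iff _).1 Q.2, conic_coord hδ Q.1 Q.2⟩⟩
  invFun x := ⟨(((x.1 : ℕ) : ℤ), x.2.1), (conic_iff _).2 x.2.2.1⟩
  left_inv Q := by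
    have hb := conic_bound hδ Q.1 Q.2
    apply Subtype.ext
    apply Prod.ext
    · simp only
      omega
    · rfl
  right_inv x := by
    obtain ⟨i, b, h⟩ := x
    rfl

theorem card_conic (δ : ℕ) (hδ : δ ≤ 8) : Nat.card {Q : Cls δ // IsConic Q} =
    sumTo (fun a => cnt δ (3 * (a : ℤ) - 2) ((a : ℤ) * (a : ℤ))) 12 := by
  have : ∀ a : Fin 12, Finite (Vecs δ (3 * ((a : ℕ) : ℤ) - 2) (((a : ℕ) : ℤ) * ((a : ℕ) : ℤ))) :=
    fun a => (card_vecs δ _ _).1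
  rw [Nat.card_congr (conicEquiv δ hδ), Nat.card_sigma, sumTo_eq]
  exact Finset.sum_congr rfl fun a _ => (card_vecs δ _ _).2

/-- The numbers of conic classes in the del Pezzo lattices of rank 1+δ for
δ = 2, …, 8. -/
theorem stmt2 :
    Nat.card {Q : Cls 2 // IsConic Q} = 2 ∧
    Nat.card {Q : Cls 3 // IsConic Q} = 3 ∧
    Nat.card {Q : Cls 4 // IsConic Q} = 5 ∧
    Nat.card {Q : Cls 5 // IsConic Q} = 10 ∧
    Nat.card {Q : Cls 6 // IsConic Q} = 27 ∧
    Nat.card {Q : Cls 7 // IsConic Q} = 126 ∧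
    Nat.card {Q : Cls 8 // IsConic Q} = 2160 := by
  refine ⟨?_, ?_, ?_, ?_, ?_, ?_, ?_⟩ <;> rw [card_conic _ (by norm_num)]
  · decide +kernel
  · decide +kernel
  · decide +kernel
  · decide +kernel
  · decide +kernel
  · decide +kernel
  · decide +kernel
end

section
/- For δ = 2, 3, 4, 5, 6, 7, 8, the number of orbits of the Weyl group W_δ acting diagonally on ordered pairs of conic classes in the del Pezzo lattice of rank 1+δ is, respectively, 2, 2, 2, 3, 3, 5, 10. -/
/-- The Weyl-group relation on ordered pairs of conic classes. -/
def pairRel (δ : ℕ)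
    (p q : {p : Cls δ × Cls δ // IsConic p.1 ∧ IsConic p.2}) : Prop :=
  ∃ g : Cls δ ≃ₗ[ℤ] Cls δ, IsWeyl g ∧ g p.1.1 = q.1.1 ∧ g p.1.2 = q.1.2

/-- The number of orbits of the Weyl group acting diagonally on ordered pairs
of conic classes. -/
noncomputable def numPairOrbits (δ : ℕ) : ℕ := Nat.card (Quot (pairRel δ))

namespace DP

theorem ip_add_left {δ : ℕ} (x y z : Cls δ) : ip (x + y) z = ip x z + ip y z := by
  simp only [ip, Prod.fst_add, Prod.snd_add, Pi.add_apply, add_mul, Finset.sum_add_distrib]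
  ring

theorem ip_smul_left {δ : ℕ} (c : ℤ) (x z : Cls δ) : ip (c • x) z = c * ip x z := by
  simp only [ip, Prod.smul_fst, Prod.smul_snd, Pi.smul_apply, smul_eq_mul, mul_sub,
    Finset.mul_sum, mul_assoc]

theorem ip_comm {δ : ℕ} (x y : Cls δ) : ip x y = ip y x := by
  simp only [ip, mul_comm]

theorem ip_add_right {δ : ℕ} (x y z : Cls δ) : ip x (y + z) = ip x y + ip x z := by
  rw [ip_comm, ip_add_left, ip_comm y, ip_comm z]

theorem ip_smul_right {δ : ℕ} (c : ℤ) (x z : Cls δ) : ip x (c • z) = c * ip x z := by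
  rw [ip_comm, ip_smul_left, ip_comm]

/-- The reflection in a root. -/
def refl {δ : ℕ} (r : Cls δ) (hr : ip r r = -2) : Cls δ ≃ₗ[ℤ] Cls δ :=
  LinearEquiv.ofInvolutive
    { toFun := fun x => x + ip x r • r
      map_add' := by intro x y; rw [ip_add_left, add_smul]; abel
      map_smul' := by
        intro c x
        simp only [ip_smul_left, RingHom.id_apply, smul_add, mul_smul] }
    (by
      intro x
      simp only [LinearMap.coe_mk, AddHom.coe_mk, ip_add_left, ip_smul_left, hr]
      rw [add_assoc, ← add_smul]
      have : ip x r + (ip x r + ip x r * -2) = 0 := by ring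
      rw [this, zero_smul, add_zero])

theorem refl_apply {δ : ℕ} (r : Cls δ) (hr : ip r r = -2) (x : Cls δ) :
    refl r hr x = x + ip x r • r := rfl

theorem refl_weyl {δ : ℕ} (r : Cls δ) (hr : ip r r = -2) (hK : ip (Kcls δ) r = 0) :
    IsWeyl (refl r hr) := by
  constructor
  · intro x y
    simp only [refl_apply, ip_add_left, ip_add_right, ip_smul_left, ip_smul_right, hr, ip_comm r y]
    ring
  · rw [refl_apply, hK, zero_smul, add_zero]

/-- Permutation of the exceptional classes. -/
def permE {δ : ℕ} (π : Equiv.Perm (Fin δ)) : Cls δ ≃ₗ[ℤ] Cls δ where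
  toFun x := (x.1, x.2 ∘ π)
  invFun x := (x.1, x.2 ∘ π.symm)
  map_add' _ _ := rfl
  map_smul' _ _ := rfl
  left_inv x := by ext <;> simp
  right_inv x := by ext <;> simp

theorem permE_weyl {δ : ℕ} (π : Equiv.Perm (Fin δ)) : IsWeyl (permE π) := by
  constructor
  · intro x y
    simp only [ip, permE, LinearEquiv.coe_mk, LinearMap.coe_mk, AddHom.coe_mk, Function.comp]
    rw [Equiv.sum_comp π (fun i => x.2 i * y.2 i)]
  · rfl

theorem weyl_trans {δ : ℕ} {g h : Cls δ ≃ₗ[ℤ] Cls δ} (hg : IsWeyl g) (hh : IsWeyl h) :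
    IsWeyl (g.trans h) := by
  refine ⟨fun x y => ?_, ?_⟩
  · simp only [LinearEquiv.trans_apply, hh.1, hg.1]
  · simp only [LinearEquiv.trans_apply, hg.2, hh.2]

theorem weyl_refl {δ : ℕ} : IsWeyl (LinearEquiv.refl ℤ (Cls δ)) := ⟨fun _ _ => rfl, rfl⟩

theorem conic_map {δ : ℕ} {g : Cls δ ≃ₗ[ℤ] Cls δ} (hg : IsWeyl g) {Q : Cls δ}
    (hQ : IsConic Q) : IsConic (g Q) := by
  refine ⟨by rw [hg.1, hQ.1], ?_⟩
  have := hg.1 (Kcls δ) Q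
  rw [hg.2] at this
  rw [this, hQ.2]

theorem conic_eqs {δ : ℕ} {Q : Cls δ} (hQ : IsConic Q) :
    ∑ i, Q.2 i * Q.2 i = Q.1 * Q.1 ∧ ∑ i, Q.2 i = 3 * Q.1 - 2 := by
  obtain ⟨h1, h2⟩ := hQ
  simp only [ip, Kcls, neg_mul, one_mul, Finset.sum_neg_distrib] at h1 h2
  constructor <;> linarith

theorem conic_pos {δ : ℕ} (hδ : δ ≤ 8) {Q : Cls δ} (hQ : IsConic Q) : 1 ≤ Q.1 := by
  obtain ⟨h1, h2⟩ := conic_eqs hQ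
  have h := sq_sum_le_card_mul_sum_sq (s := Finset.univ) (f := Q.2)
  simp only [Finset.card_univ, Fintype.card_fin, sq] at h
  rw [h1, h2] at h
  have h8 : (δ : ℤ) ≤ 8 := by exact_mod_cast hδ
  nlinarith [mul_self_nonneg Q.1]

theorem conic_nonneg {δ : ℕ} (hδ : δ ≤ 8) {Q : Cls δ} (hQ : IsConic Q) (i : Fin δ) :
    0 ≤ Q.2 i := by
  have ha := conic_pos hδ hQ
  obtain ⟨h1, h2⟩ := conic_eqs hQ
  have h := sq_sum_le_card_mul_sum_sq (s := Finset.univ.erase i) (f := Q.2)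
  rw [Finset.card_erase_of_mem (Finset.mem_univ i)] at h
  rw [← Finset.add_sum_erase _ _ (Finset.mem_univ i)] at h1 h2
  simp only [Finset.card_univ, Fintype.card_fin, sq] at h
  have h8 : ((δ - 1 : ℕ) : ℤ) ≤ 7 := by
    have : δ - 1 ≤ 7 := by omega
    exact_mod_cast this
  have hn : 0 ≤ ∑ x ∈ Finset.univ.erase i, Q.2 x * Q.2 x :=
    Finset.sum_nonneg fun x _ => mul_self_nonneg _
  have h3 := h.trans (mul_le_mul_of_nonneg_right h8 hn)
  have e1 : ∑ x ∈ Finset.univ.erase i, Q.2 x * Q.2 x = Q.1 * Q.1 - Q.2 i * Q.2 i := by linarith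
  have e2 : ∑ x ∈ Finset.univ.erase i, Q.2 x = 3 * Q.1 - 2 - Q.2 i := by linarith
  rw [e1, e2] at h3
  generalize Q.2 i = b at *
  generalize Q.1 = a at *
  by_contra hb
  obtain ⟨m, rfl⟩ : ∃ m, b = -m := ⟨-b, by ring⟩
  have hm : 1 ≤ m := by omega
  rcases eq_or_lt_of_le hm with rfl | hm
  · nlinarith [mul_self_nonneg (2 * a - 3)]
  · have : 2 ≤ m := hm
    nlinarith [mul_nonneg (show (0:ℤ) ≤ a by linarith) (show (0:ℤ) ≤ m - 2 by linarith)]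

/-- The Cremona root. -/
def cr {δ : ℕ} (i j k : Fin δ) : Cls δ :=
  (1, Pi.single i 1 + Pi.single j 1 + Pi.single k 1)

theorem ip_cr {δ : ℕ} (x : Cls δ) (i j k : Fin δ) :
    ip x (cr i j k) = x.1 - x.2 i - x.2 j - x.2 k := by
  simp only [ip, cr, Pi.add_apply, mul_add, Finset.sum_add_distrib, Pi.single_apply, mul_ite,
    mul_one, mul_zero, Finset.sum_ite_eq', Finset.mem_univ, if_true]
  ring

theorem cr_self {δ : ℕ} {i j k : Fin δ} (hij : i ≠ j) (hik : i ≠ k) (hjk : j ≠ k) :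
    ip (cr i j k) (cr i j k) = -2 := by
  rw [ip_cr]
  simp [cr, Pi.single_apply, hij, hik, hjk, hij.symm, hik.symm, hjk.symm]

theorem cr_K {δ : ℕ} (i j k : Fin δ) : ip (Kcls δ) (cr i j k) = 0 := by
  rw [ip_cr]; simp [Kcls]

/-- The standard conic. -/
def Q0 (n : ℕ) : Cls (n + 1) := (1, Pi.single 0 1)

theorem one_case {n : ℕ} {Q : Cls (n + 1)} (hQ : IsConic Q) (ha : Q.1 = 1) :
    ∃ g : Cls (n + 1) ≃ₗ[ℤ] Cls (n + 1), IsWeyl g ∧ g Q = Q0 n := by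
  obtain ⟨h1, h2⟩ := conic_eqs hQ
  rw [ha] at h1 h2
  have : ∃ i, Q.2 i ≠ 0 := by
    by_contra hc
    push Not at hc
    simp [hc] at h2
  obtain ⟨i, hi⟩ := this
  have e1 := Finset.add_sum_erase Finset.univ (fun x => Q.2 x * Q.2 x) (Finset.mem_univ i)
  have e2 := Finset.add_sum_erase Finset.univ Q.2 (Finset.mem_univ i)
  have hn : ∀ x ∈ Finset.univ.erase i, 0 ≤ Q.2 x * Q.2 x := fun x _ => mul_self_nonneg _
  have hp : 0 < Q.2 i * Q.2 i := mul_self_pos.2 hi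
  have hs := Finset.sum_nonneg hn
  have hz : ∑ x ∈ Finset.univ.erase i, Q.2 x * Q.2 x = 0 := by
    linarith
  have hz' : ∀ x, x ≠ i → Q.2 x = 0 := fun x hx => by
    have := (Finset.sum_eq_zero_iff_of_nonneg hn).1 hz x (by simp [hx])
    simpa using this
  have hi1 : Q.2 i = 1 := by
    have : ∑ x ∈ Finset.univ.erase i, Q.2 x = 0 :=
      Finset.sum_eq_zero fun x hx => hz' x (Finset.ne_of_mem_erase hx)
    linarith
  refine ⟨permE (Equiv.swap 0 i), permE_weyl _, ?_⟩
  ext x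
  · exact ha
  · change Q.2 (Equiv.swap 0 i x) = (Pi.single 0 1 : Fin (n + 1) → ℤ) x
    by_cases hx : x = 0
    · subst hx; simp [hi1]
    · rw [Pi.single_eq_of_ne hx]
      apply hz'
      intro hc
      apply hx
      exact (Equiv.swap 0 i).injective (hc.trans (Equiv.swap_apply_left 0 i).symm)

theorem reduced_one {n : ℕ} (h1n : 1 ≤ n) (hn : n ≤ 7) {Q : Cls (n + 1)} (hQ : IsConic Q)
    (hred : ∀ i j k : Fin (n + 1), i ≠ j → i ≠ k → j ≠ k → Q.2 i + Q.2 j + Q.2 k ≤ Q.1) :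
    Q.1 = 1 := by
  have ha := conic_pos (by omega) hQ
  have hb := conic_nonneg (by omega) hQ
  obtain ⟨h1, h2⟩ := conic_eqs hQ
  rcases eq_or_lt_of_le h1n with rfl | h2n
  · rw [Fin.sum_univ_succ] at h1 h2
    simp only [Nat.reduceAdd, Finset.univ_unique, Fin.default_eq_zero, Finset.sum_singleton,
      Fin.succ_zero_eq_one] at h1 h2
    nlinarith [mul_self_nonneg (Q.2 0 - Q.2 1), hb 0, hb 1]
  obtain ⟨i, -, hi⟩ := Finset.exists_max_image Finset.univ Q.2 ⟨0, Finset.mem_univ _⟩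
  obtain ⟨j, hj0, hj⟩ := Finset.exists_max_image (Finset.univ.erase i) Q.2
    (Finset.card_pos.1 (by rw [Finset.card_erase_of_mem (Finset.mem_univ i)]; simp; omega))
  obtain ⟨k, hk0, hk⟩ := Finset.exists_max_image ((Finset.univ.erase i).erase j) Q.2
    (Finset.card_pos.1 (by
      rw [Finset.card_erase_of_mem hj0, Finset.card_erase_of_mem (Finset.mem_univ i)]
      simp; omega))
  have hji : j ≠ i := Finset.ne_of_mem_erase hj0
  have hkj : k ≠ j := Finset.ne_of_mem_erase hk0
  have hki : k ≠ i := Finset.ne_of_mem_erase (Finset.mem_of_mem_erase hk0)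
  have hr := hred i j k hji.symm hki.symm hkj.symm
  have e1 := Finset.add_sum_erase Finset.univ (fun x => Q.2 x * (Q.2 x - Q.2 k))
    (Finset.mem_univ i)
  have e2 := Finset.add_sum_erase (Finset.univ.erase i) (fun x => Q.2 x * (Q.2 x - Q.2 k)) hj0
  have e3 : ∑ x ∈ (Finset.univ.erase i).erase j, Q.2 x * (Q.2 x - Q.2 k) ≤ 0 := by
    apply Finset.sum_nonpos
    intro x hx
    have := hk x hx
    exact mul_nonpos_of_nonneg_of_nonpos (hb x) (by linarith)
  have e4 : ∑ x, Q.2 x * (Q.2 x - Q.2 k) = Q.1 * Q.1 - (3 * Q.1 - 2) * Q.2 k := by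
    simp only [mul_sub, Finset.sum_sub_distrib, ← Finset.sum_mul, h1, h2]
  have hjk : Q.2 k ≤ Q.2 j := hj k (Finset.mem_of_mem_erase hk0)
  have hij : Q.2 j ≤ Q.2 i := hi j (Finset.mem_univ _)
  have hk' := hb k
  have hs2 : Q.2 i * Q.2 i ≤ Q.1 * Q.1 := by
    rw [← h1]
    exact Finset.single_le_sum (f := fun x => Q.2 x * Q.2 x)
      (fun x _ => mul_self_nonneg _) (Finset.mem_univ i)
  have key : Q.1 * Q.1 - (3 * Q.1 - 2) * Q.2 k ≤
      Q.2 i * (Q.2 i - Q.2 k) + Q.2 j * (Q.2 j - Q.2 k) := by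
    linarith
  have ht : Q.2 k = 0 := by
    generalize Q.2 k = t at *
    generalize Q.2 i = u at *
    generalize Q.2 j = v at *
    generalize Q.1 = a at *
    by_contra hne
    have ht1 : 1 ≤ t := by omega
    have hu : u ≤ a - t - v := by linarith
    -- convexity
    have c1 : u * (u - t) + v * (v - t) ≤ a * a - 5 * a * t + 6 * t * t := by
      nlinarith [mul_nonneg (sub_nonneg.2 hjk) (sub_nonneg.2 hij),
        mul_nonneg (sub_nonneg.2 hu) (show 0 ≤ u - t by linarith),
        mul_nonneg (sub_nonneg.2 hu) (show 0 ≤ v - t by linarith),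
        mul_nonneg (show 0 ≤ u - t by linarith) (show 0 ≤ v - t by linarith),
        mul_nonneg (sub_nonneg.2 hu) hk', mul_nonneg (sub_nonneg.2 hu) (sub_nonneg.2 hu)]
    nlinarith
  have hz : ∀ x, x ≠ i → x ≠ j → Q.2 x = 0 := fun x hx hx' =>
    le_antisymm (ht ▸ hk x (by simp [hx, hx'])) (hb x)
  have hsum : Q.2 i + Q.2 j = 3 * Q.1 - 2 := by
    rw [← h2, ← Finset.add_sum_erase _ _ (Finset.mem_univ i), ← Finset.add_sum_erase _ _ hj0,
      Finset.sum_eq_zero (s := (Finset.univ.erase i).erase j), add_zero]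
    intro x hx
    exact hz x (Finset.ne_of_mem_erase (Finset.mem_of_mem_erase hx)) (Finset.ne_of_mem_erase hx)
  linarith

theorem step1 {n : ℕ} (h1n : 1 ≤ n) (hn : n ≤ 7) : ∀ (N : ℕ) (Q : Cls (n + 1)), IsConic Q →
    Q.1 ≤ N → ∃ g : Cls (n + 1) ≃ₗ[ℤ] Cls (n + 1), IsWeyl g ∧ g Q = Q0 n := by
  intro N
  induction N with
  | zero =>
    intro Q hQ hN
    have := conic_pos (by omega) hQ
    simp at hN
    omega
  | succ N ih =>
    intro Q hQ hN
    by_cases hred : ∀ i j k : Fin (n + 1), i ≠ j → i ≠ k → j ≠ k →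
        Q.2 i + Q.2 j + Q.2 k ≤ Q.1
    · exact one_case hQ (reduced_one h1n hn hQ hred)
    · push Not at hred
      obtain ⟨i, j, k, hij, hik, hjk, hlt⟩ := hred
      have hw := refl_weyl (cr i j k) (cr_self hij hik hjk) (cr_K i j k)
      obtain ⟨g, hg, hgQ⟩ := ih (refl (cr i j k) (cr_self hij hik hjk) Q) (conic_map hw hQ) (by
        rw [refl_apply, ip_cr]
        simp only [Prod.fst_add, Prod.smul_fst, cr, smul_eq_mul]
        push_cast at hN
        linarith)
      exact ⟨_, weyl_trans hw hg, hgQ⟩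

theorem step2 {n : ℕ} (hn : n ≤ 7) : ∀ (N : ℕ) (Q : Cls (n + 1)), IsConic Q →
    Q.1 ≤ N → ∃ g : Cls (n + 1) ≃ₗ[ℤ] Cls (n + 1), IsWeyl g ∧ g (Q0 n) = Q0 n ∧
      ∀ i j : Fin n, i ≠ j → (g Q).2 i.succ + (g Q).2 j.succ ≤ (g Q).1 - (g Q).2 0 := by
  intro N
  induction N with
  | zero =>
    intro Q hQ hN
    have := conic_pos (by omega) hQ
    simp at hN
    omega
  | succ N ih =>
    intro Q hQ hN
    by_cases hred : ∀ i j : Fin n, i ≠ j → Q.2 i.succ + Q.2 j.succ ≤ Q.1 - Q.2 0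
    · exact ⟨_, weyl_refl, rfl, hred⟩
    · push Not at hred
      obtain ⟨i, j, hij, hlt⟩ := hred
      have hs := cr_self (Fin.succ_ne_zero i).symm (Fin.succ_ne_zero j).symm
        (fun h => hij (Fin.succ_injective _ h))
      have hw := refl_weyl (cr 0 i.succ j.succ) hs (cr_K _ _ _)
      obtain ⟨g, hg, hg0, hgQ⟩ := ih (refl _ hs Q) (conic_map hw hQ) (by
        rw [refl_apply, ip_cr]
        simp only [Prod.fst_add, Prod.smul_fst, cr, smul_eq_mul]
        push_cast at hN
        linarith)
      refine ⟨_, weyl_trans hw hg, ?_, hgQ⟩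
      rw [LinearEquiv.trans_apply, refl_apply, ip_cr]
      simp [Q0, Pi.single_apply, Fin.succ_ne_zero]
      exact hg0

/-- Sort the last `n` coordinates. -/
theorem step3 {n : ℕ} (Q : Cls (n + 1))
    (hQ : ∀ i j : Fin n, i ≠ j → Q.2 i.succ + Q.2 j.succ ≤ Q.1 - Q.2 0) :
    ∃ g : Cls (n + 1) ≃ₗ[ℤ] Cls (n + 1), IsWeyl g ∧ g (Q0 n) = Q0 n ∧
      (∀ i j : Fin n, i ≠ j → (g Q).2 i.succ + (g Q).2 j.succ ≤ (g Q).1 - (g Q).2 0) ∧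
      (∀ i j : Fin n, i ≤ j → (g Q).2 j.succ ≤ (g Q).2 i.succ) := by
  let f : Fin n → ℤ := fun i => - Q.2 i.succ
  have hm := Tuple.monotone_sort f
  let σ := Tuple.sort f
  let π : Equiv.Perm (Fin (n + 1)) := Equiv.Perm.decomposeFin.symm (0, σ)
  have h0 : π 0 = 0 := by simp [π]
  have hs : ∀ i : Fin n, π i.succ = (σ i).succ := by intro i; simp [π]
  refine ⟨permE π, permE_weyl _, ?_, ?_, ?_⟩
  · ext x
    · rfl
    · change (Pi.single 0 1 : Fin (n + 1) → ℤ) (π x) = (Pi.single 0 1 : Fin (n + 1) → ℤ) x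
      refine Fin.cases ?_ (fun i => ?_) x
      · rw [h0]
      · rw [hs, Pi.single_eq_of_ne (Fin.succ_ne_zero _), Pi.single_eq_of_ne (Fin.succ_ne_zero _)]
  · intro i j hij
    change Q.2 (π i.succ) + Q.2 (π j.succ) ≤ Q.1 - Q.2 (π 0)
    rw [h0, hs, hs]
    exact hQ _ _ (fun h => hij (σ.injective h))
  · intro i j hij
    change Q.2 (π j.succ) ≤ Q.2 (π i.succ)
    rw [hs, hs]
    have := hm hij
    simp only [Function.comp, f] at this
    exact neg_le_neg_iff.1 this

/-- The ten normal forms: intersection number with `Q0`. -/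
def D : Fin 10 → ℕ := ![0, 1, 2, 3, 4, 4, 5, 6, 7, 8]

/-- The ten normal forms: last coordinates. -/
def T : Fin 10 → Fin 7 → ℕ :=
  ![![0, 0, 0, 0, 0, 0, 0], ![1, 0, 0, 0, 0, 0, 0], ![1, 1, 1, 1, 0, 0, 0],
    ![2, 1, 1, 1, 1, 1, 0], ![2, 2, 2, 2, 2, 2, 0], ![2, 2, 2, 1, 1, 1, 1],
    ![2, 2, 2, 2, 2, 2, 1], ![3, 3, 3, 3, 2, 2, 2], ![3, 3, 3, 3, 3, 3, 3],
    ![4, 4, 4, 4, 4, 4, 4]]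

/-- The ten normal forms: degree. -/
def A : Fin 10 → ℤ := ![1, 1, 2, 3, 5, 4, 5, 7, 8, 11]

/-- The number of normal forms. -/
def cnt : Fin 8 → ℕ := ![0, 2, 2, 2, 3, 3, 5, 10]

/-- The condition on the sorted last coordinates. -/
def Leaf (d b1 b2 b3 b4 b5 b6 b7 : ℕ) : Prop :=
  b1 * (d - b1) + b2 * (d - b2) + b3 * (d - b3) + b4 * (d - b4) + b5 * (d - b5)
      + b6 * (d - b6) + b7 * (d - b7) = 2 * (d * (d - 1)) →
    (b1 + b2 + b3 + b4 + b5 + b6 + b7 + d) % 2 = 0 →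
    ∃ k : Fin 10, D k = d ∧ T k = ![b1, b2, b3, b4, b5, b6, b7]

instance decLeaf (d b1 b2 b3 b4 b5 b6 b7 : ℕ) : Decidable (Leaf d b1 b2 b3 b4 b5 b6 b7) := by
  unfold Leaf
  infer_instance

/-- The quantifiers over the last four coordinates. -/
def Branch (d b1 b2 b3 : ℕ) : Prop := ∀ b4 < b3 + 1, ∀ b5 < b4 + 1, ∀ b6 < b5 + 1,
  ∀ b7 < b6 + 1, Leaf d b1 b2 b3 b4 b5 b6 b7

instance decBranch (d b1 b2 b3 : ℕ) : Decidable (Branch d b1 b2 b3) := by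
  unfold Branch
  infer_instance

theorem enum : ∀ d < 9, ∀ b1 < d + 1, ∀ b2 < min b1 (d - b1) + 1, ∀ b3 < b2 + 1,
    Branch d b1 b2 b3 := by
  decide +kernel

theorem T_cnt : ∀ n : Fin 8, 1 ≤ n.val → ∀ k : Fin 10,
    (∀ i : Fin 7, n.val ≤ i.val → T k i = 0) → k.val < cnt n := by
  decide +kernel

theorem A_eq : ∀ k : Fin 10, 2 * A k = (∑ i, (T k i : ℤ)) + 2 - D k := by
  decide +kernel

/-- Representatives of the second conic. -/
def R (n : ℕ) (hn : n ≤ 7) (k : Fin 10) : Cls (n + 1) :=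
  (A k, Fin.cons (A k - D k) (fun i : Fin n => (T k (Fin.castLE hn i) : ℤ)))

theorem pad_sum {n : ℕ} (hn : n ≤ 7) (F : Fin n → ℤ) :
    ∑ i : Fin 7, (if h : i.val < n then F ⟨i, h⟩ else 0) = ∑ i, F i := by
  obtain ⟨m, hm⟩ : ∃ m, m = 7 := ⟨7, rfl⟩
  rw [← hm] at hn
  obtain ⟨l, rfl⟩ : ∃ l, m = n + l := ⟨m - n, by omega⟩
  rw [← hm, Fin.sum_univ_add]
  simp

theorem step4 {n : ℕ} (h1n : 1 ≤ n) (hn : n ≤ 7) (Q : Cls (n + 1)) (hQ : IsConic Q)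
    (hp : ∀ i j : Fin n, i ≠ j → Q.2 i.succ + Q.2 j.succ ≤ Q.1 - Q.2 0)
    (hs : ∀ i j : Fin n, i ≤ j → Q.2 j.succ ≤ Q.2 i.succ) :
    ∃ k : Fin 10, k.val < cnt ⟨n, by omega⟩ ∧ Q = R n hn k := by
  obtain ⟨h1, h2⟩ := conic_eqs hQ
  have hb := conic_nonneg (by omega) hQ
  rw [Fin.sum_univ_succ] at h1 h2
  obtain ⟨d, hd⟩ : ∃ d, d = Q.1 - Q.2 0 := ⟨_, rfl⟩
  have hb0 : Q.2 0 = Q.1 - d := by rw [hd]; ring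
  rw [hb0] at h1 h2
  rw [← hd] at hp
  have e : ∑ i : Fin n, Q.2 i.succ * (d - Q.2 i.succ) = 2 * (d * (d - 1)) := by
    simp only [mul_sub, Finset.sum_sub_distrib, ← Finset.sum_mul]
    linear_combination d * h2 - h1
  have e' : ∑ i : Fin n, Q.2 i.succ = 2 * Q.1 - 2 + d := by linarith
  have hbd : 8 * (d * (d - 1)) ≤ 7 * (d * d) := by
    have : ∑ i : Fin n, 4 * (Q.2 i.succ * (d - Q.2 i.succ)) ≤ ∑ i : Fin n, d * d :=
      Finset.sum_le_sum fun i _ => by nlinarith [mul_self_nonneg (2 * Q.2 i.succ - d)]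
    rw [← Finset.mul_sum, e] at this
    simp only [Finset.sum_const, Finset.card_univ, Fintype.card_fin, nsmul_eq_mul] at this
    have h7 : (n : ℤ) ≤ 7 := by exact_mod_cast hn
    nlinarith [mul_self_nonneg d]
  have hd0 : 0 ≤ d := by nlinarith
  have hd8 : d ≤ 8 := by nlinarith
  -- natural number versions
  lift d to ℕ using hd0
  let c : Fin n → ℕ := fun i => (Q.2 i.succ).toNat
  have hc : ∀ i, Q.2 i.succ = (c i : ℤ) := fun i => (Int.toNat_of_nonneg (hb _)).symm
  let B : Fin 7 → ℕ := fun i => if h : i.val < n then c ⟨i, h⟩ else 0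
  have hanti : ∀ i j : Fin 7, i ≤ j → B j ≤ B i := by
    intro i j hij
    by_cases hj : j.val < n
    · have hi : i.val < n := lt_of_le_of_lt hij hj
      have := hs ⟨i, hi⟩ ⟨j, hj⟩ hij
      simp only [B, hi, hj, dif_pos]
      rw [hc, hc] at this
      exact_mod_cast this
    · simp [B, hj]
  have hB0 : B 0 ≤ d ∧ B 0 + B 1 ≤ d := by
    rcases eq_or_lt_of_le h1n with h | h
    · subst h
      have h01 : B 1 = 0 := by simp [B]
      have h00 : (B 0 : ℤ) = Q.2 1 := by
        have := hc 0
        simp [B]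
        exact this.symm
      rw [h01]
      have : B 0 ≤ d := by
        simp only [Finset.univ_unique, Fin.default_eq_zero, Finset.sum_singleton,
          Fin.succ_zero_eq_one] at e
        rw [← h00] at e
        by_contra hlt
        push Not at hlt
        have hl : (d : ℤ) + 1 ≤ B 0 := by exact_mod_cast hlt
        rcases Nat.eq_zero_or_pos d with hz | hz
        · subst hz
          simp at e
          omega
        · have hz' : (1 : ℤ) ≤ d := by exact_mod_cast hz
          nlinarith
      omega
    · have := hp ⟨0, by omega⟩ ⟨1, h⟩ (by simp)
      rw [hc, hc] at this
      have h2 : B 0 + B 1 ≤ d := by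
        have h0 : 0 < n := by omega
        simp [B, h, h0]
        exact_mod_cast this
      omega
  have hle : ∀ i, B i ≤ d := fun i => (hanti 0 i (Fin.zero_le _)).trans hB0.1
  have eB : ∑ i : Fin 7, B i * (d - B i) = 2 * (d * (d - 1)) := by
    zify
    have : ∀ i : Fin 7, (B i : ℤ) * ((d - B i : ℕ) : ℤ) =
        if h : i.val < n then (fun j : Fin n => Q.2 j.succ * (d - Q.2 j.succ)) ⟨i, h⟩ else 0 := by
      intro i
      rw [Nat.cast_sub (hle i)]
      by_cases h : i.val < n
      · simp only [B, h, dif_pos, hc]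
      · simp [B, h]
    rw [Finset.sum_congr rfl fun i _ => this i, pad_sum hn (fun j : Fin n => Q.2 j.succ * (d - Q.2 j.succ)), e]
    rcases Nat.eq_zero_or_pos d with hz | hz
    · subst hz; simp
    · rw [Nat.cast_sub hz]; simp
  have eB' : ((∑ i : Fin 7, B i : ℕ) : ℤ) = 2 * Q.1 - 2 + d := by
    push_cast
    have : ∀ i : Fin 7, (B i : ℤ) =
        if h : i.val < n then (fun j : Fin n => Q.2 j.succ) ⟨i, h⟩ else 0 := by
      intro i
      by_cases h : i.val < n
      · simp only [B, h, dif_pos, hc]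
      · simp [B, h]
    rw [Finset.sum_congr rfl fun i _ => this i, pad_sum hn (fun j : Fin n => Q.2 j.succ), e']
  have eS := eB'
  simp only [Fin.sum_univ_seven] at eB eS
  obtain ⟨k, hk1, hk2⟩ := enum d (by omega) (B 0) (by omega) (B 1)
    (by have := hanti 0 1 (by decide); omega)
    (B 2) (by have := hanti 1 2 (by decide); omega)
    (B 3) (by have := hanti 2 3 (by decide); omega)
    (B 4) (by have := hanti 3 4 (by decide); omega)
    (B 5) (by have := hanti 4 5 (by decide); omega)
    (B 6) (by have := hanti 5 6 (by decide); omega) eB (by omega)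
  have hTB : ∀ i, T k i = B i := by
    intro i
    rw [hk2]
    fin_cases i <;> rfl
  have hA : Q.1 = A k := by
    have := A_eq k
    rw [Finset.sum_congr rfl fun i _ => congrArg _ (hTB i), hk1] at this
    push_cast at eB'
    linarith
  refine ⟨k, T_cnt ⟨n, by omega⟩ h1n k ?_, ?_⟩
  · intro i hi
    rw [hTB]
    have : ¬ i.val < n := by simpa using hi
    simp [B, this]
  · refine Prod.ext hA (funext fun x => ?_)
    refine Fin.cases ?_ (fun i => ?_) x
    · simp only [R, Fin.cons_zero]
      rw [hb0, hA, hk1]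
    · simp only [R, Fin.cons_succ]
      rw [hTB, hc]
      simp [B]

theorem normal {n : ℕ} (h1n : 1 ≤ n) (hn : n ≤ 7) (P Q : Cls (n + 1)) (hP : IsConic P)
    (hQ : IsConic Q) : ∃ g : Cls (n + 1) ≃ₗ[ℤ] Cls (n + 1), IsWeyl g ∧ g P = Q0 n ∧
      ∃ k : Fin 10, k.val < cnt ⟨n, by omega⟩ ∧ g Q = R n hn k := by
  obtain ⟨g1, w1, h1⟩ := step1 h1n hn P.1.toNat P hP (Int.self_le_toNat _)
  obtain ⟨g2, w2, h2, r2⟩ := step2 hn (g1 Q).1.toNat (g1 Q) (conic_map w1 hQ) (Int.self_le_toNat _)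
  obtain ⟨g3, w3, h3, r3, s3⟩ := step3 _ r2
  have hc := conic_map w3 (conic_map w2 (conic_map w1 hQ))
  obtain ⟨k, hk, hR⟩ := step4 h1n hn _ hc r3 s3
  refine ⟨(g1.trans g2).trans g3, weyl_trans (weyl_trans w1 w2) w3, ?_, k, hk, hR⟩
  simp only [LinearEquiv.trans_apply, h1, h2, h3]

theorem ip_Q0_R {n : ℕ} (hn : n ≤ 7) (k : Fin 10) : ip (Q0 n) (R n hn k) = D k := by
  simp [ip, Q0, R, Pi.single_apply]

theorem conic_Q0 (n : ℕ) : IsConic (Q0 n) := by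
  constructor <;> simp [ip, Q0, Kcls, Pi.single_apply]

theorem count {n : ℕ} (h1n : 1 ≤ n) (hn : n ≤ 7) {c : ℕ} (hcn : cnt ⟨n, by omega⟩ = c)
    (hR : ∀ k : Fin 10, k.val < cnt ⟨n, by omega⟩ → IsConic (R n hn k)) :
    numPairOrbits (n + 1) = c := by
  rw [← hcn]
  have h10 : cnt ⟨n, by omega⟩ ≤ 10 := by
    generalize (⟨n, by omega⟩ : Fin 8) = m
    revert m
    decide
  let F : Fin (cnt ⟨n, by omega⟩) → Quot (pairRel (n + 1)) := fun k =>
    Quot.mk _ ⟨(Q0 n, R n hn (Fin.castLE h10 k)), conic_Q0 n, hR _ k.2⟩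
  let J : Quot (pairRel (n + 1)) → ℤ × Prop :=
    Quot.lift (fun p => (ip p.1.1 p.1.2, ∃ z : Cls (n + 1), p.1.1 + p.1.2 = z + z)) (by
      rintro ⟨⟨a, b⟩, hab⟩ ⟨⟨a', b'⟩, hab'⟩ ⟨g, hg, h1, h2⟩
      simp only at h1 h2
      subst h1 h2
      simp only [Prod.mk.injEq, hg.1, true_and, eq_iff_iff]
      constructor
      · rintro ⟨z, hz⟩
        exact ⟨g z, by rw [← map_add, hz, map_add]⟩
      · rintro ⟨z, hz⟩
        refine ⟨g.symm z, g.injective ?_⟩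
        rw [map_add, hz, map_add, LinearEquiv.apply_symm_apply])
  have hbij : Function.Bijective F := by
    constructor
    · intro k l hkl
      have hJ : J (F k) = J (F l) := by rw [hkl]
      simp only [J, F, Prod.mk.injEq, ip_Q0_R] at hJ
      obtain ⟨hD, hz⟩ := hJ
      have hD' : D (Fin.castLE h10 k) = D (Fin.castLE h10 l) := by exact_mod_cast hD
      have key : ∀ k l : Fin 10, D k = D l → k = l ∨ (k = 4 ∧ l = 5) ∨ (k = 5 ∧ l = 4) := by
        decide
      have h5 : 5 < cnt ⟨n, by omega⟩ → n = 7 := by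
        intro h
        have : ∀ m : Fin 8, 5 < cnt m → m.val = 7 := by decide
        exact this _ h
      have no : n = 7 → (∃ z : Cls (n + 1), Q0 n + R n hn 4 = z + z) ∧
          ¬ (∃ z : Cls (n + 1), Q0 n + R n hn 5 = z + z) := by
        intro h
        subst h
        constructor
        · exact ⟨(3, ![1, 1, 1, 1, 1, 1, 1, 0]), by clear * -; revert hn; decide +kernel⟩
        · rintro ⟨z, hz⟩
          have := congrArg Prod.fst hz
          simp [Q0, R, A] at this
          omega
      rcases key _ _ hD' with h | ⟨h, h'⟩ | ⟨h, h'⟩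
      · exact Fin.castLE_injective h10 h
      · have hv := congrArg Fin.val h'
        simp at hv
        have := no (h5 (by have := l.2; omega))
        rw [h, h'] at hz
        exact absurd (hz ▸ this.1) this.2
      · have hv := congrArg Fin.val h
        simp at hv
        have := no (h5 (by have := k.2; omega))
        rw [h, h'] at hz
        exact absurd (hz ▸ this.1) this.2
    · intro q
      induction q using Quot.ind with
      | mk p =>
        obtain ⟨⟨P, Q⟩, hP, hQ⟩ := p
        obtain ⟨g, hg, h1, k, hk, h2⟩ := normal h1n hn P Q hP hQ
        exact ⟨⟨k, hk⟩, (Quot.sound ⟨g, hg, h1, h2⟩).symm⟩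
  have := Nat.card_eq_of_bijective F hbij
  rw [numPairOrbits, ← this, Nat.card_eq_fintype_card, Fintype.card_fin]

end DP

/-- The number of Weyl-group orbits of ordered pairs of conic classes, for
δ = 2, …, 8. -/
theorem stmt8 :
    numPairOrbits 2 = 2 ∧ numPairOrbits 3 = 2 ∧ numPairOrbits 4 = 2 ∧
    numPairOrbits 5 = 3 ∧ numPairOrbits 6 = 3 ∧ numPairOrbits 7 = 5 ∧
    numPairOrbits 8 = 10 := by
  refine ⟨DP.count (n := 1) (by decide) (by decide) rfl ?_,
    DP.count (n := 2) (by decide) (by decide) rfl ?_, DP.count (n := 3) (by decide) (by decide) rfl ?_,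
    DP.count (n := 4) (by decide) (by decide) rfl ?_, DP.count (n := 5) (by decide) (by decide) rfl ?_,
    DP.count (n := 6) (by decide) (by decide) rfl ?_, DP.count (n := 7) (by decide) (by decide) rfl ?_⟩ <;>
  · unfold IsConic
    decide +kernel
end

section
/- In the del Pezzo lattice of rank 9 (δ = 8), let V = (4; 2, 1, 1, 1, 1, 1, 1, 1) (so that V = −K + Q where Q = ℓ − e₁ is a conic class). Suppose V = C₁ + C₂ where C₁ is a (−1)-class and C₂ satisfies C₂·L ≥ 0 for every (−1)-class L. Then, up to a simultaneous permutation of the coordinates b₂, …, b₈, the pair (C₁, C₂) is one of the following six: ((3;2,1,1,1,1,1,1,0), (1;0,0,0,0,0,0,0,1)); ((2;1,1,1,1,1,0,0,0), (2;1,0,0,0,0,1,1,1)); ((1;0,0,0,0,0,0,1,1), (3;2,1,1,1,1,1,0,0)); ((0;−1,0,0,0,0,0,0,0), (4;3,1,1,1,1,1,1,1)); ((1;1,1,0,0,0,0,0,0), (3;1,0,1,1,1,1,1,1)); ((0;0,0,−1,0,0,0,0,0), (4;2,1,2,1,1,1,1,1)). -/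
/-- The six possible decompositions of V = (4; 2,1,1,1,1,1,1,1), up to a
permutation of the coordinates b₂, …, b₈. -/
def sixPairs : List (Cls 8 × Cls 8) :=
  [ ((3, ![2,1,1,1,1,1,1,0]), (1, ![0,0,0,0,0,0,0,1])),
    ((2, ![1,1,1,1,1,0,0,0]), (2, ![1,0,0,0,0,1,1,1])),
    ((1, ![0,0,0,0,0,0,1,1]), (3, ![2,1,1,1,1,1,0,0])),
    ((0, ![-1,0,0,0,0,0,0,0]), (4, ![3,1,1,1,1,1,1,1])),
    ((1, ![1,1,0,0,0,0,0,0]), (3, ![1,0,1,1,1,1,1,1])),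
    ((0, ![0,0,-1,0,0,0,0,0]), (4, ![2,1,2,1,1,1,1,1])) ]

lemma exists_perm_aux (S T : Finset (Fin 8)) (hS : (0 : Fin 8) ∉ S) (hT : (0 : Fin 8) ∉ T)
    (h : S.card = T.card) :
    ∃ σ : Equiv.Perm (Fin 8), σ 0 = 0 ∧ ∀ i, σ i ∈ S ↔ i ∈ T := by
  classical
  have e : {x // x ∈ T} ≃ {x // x ∈ S} := Finset.equivOfCardEq h.symm
  have hτ : ∀ i, e.extendSubtype i ∈ S ↔ i ∈ T := by
    intro i
    constructor
    · intro hi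
      by_contra hn
      exact e.extendSubtype_not_mem i hn hi
    · exact fun hi => e.extendSubtype_mem i hi
  have h0 : e.extendSubtype 0 ∉ S := fun hh => hT ((hτ 0).1 hh)
  refine ⟨e.extendSubtype.trans (Equiv.swap (e.extendSubtype 0) 0), by simp, ?_⟩
  intro i
  rw [← hτ i, Equiv.trans_apply]
  by_cases h1 : e.extendSubtype i = e.extendSubtype 0
  · rw [h1, Equiv.swap_apply_left]
    exact ⟨fun h => absurd h hS, fun h => absurd h h0⟩
  by_cases h2 : e.extendSubtype i = 0
  · rw [h2, Equiv.swap_apply_right]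
    exact ⟨fun h => absurd h h0, fun h => absurd h hS⟩
  rw [Equiv.swap_apply_of_ne_of_ne h1 h2]

/-- Normal form: if `b` is constant `u` on a set `S` avoiding `0` and vanishes elsewhere off `0`,
then `b` can be moved to any target of the same shape. -/
lemma move_aux (b : Fin 8 → ℤ) (u : ℤ) (S T : Finset (Fin 8))
    (hS : (0 : Fin 8) ∉ S) (hT : (0 : Fin 8) ∉ T) (h : S.card = T.card)
    (h1 : ∀ i ∈ S, b i = u) (h2 : ∀ i, i ≠ 0 → i ∉ S → b i = 0) :
    ∃ σ : Equiv.Perm (Fin 8), σ 0 = 0 ∧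
      ∀ i, b (σ i) = if i = 0 then b 0 else if i ∈ T then u else 0 := by
  obtain ⟨σ, h0, hσ⟩ := exists_perm_aux S T hS hT h
  refine ⟨σ, h0, fun i => ?_⟩
  by_cases hi : i = 0
  · simp [hi, h0]
  by_cases hiT : i ∈ T
  · simp [hi, hiT, h1 _ ((hσ i).2 hiT)]
  · have hne : σ i ≠ 0 := fun hh => hi (σ.injective (hh.trans h0.symm))
    simp [hi, hiT, h2 _ hne (fun hh => hiT ((hσ i).1 hh))]

theorem stmt16 (C₁ C₂ : Cls 8)
    (hsum : C₁ + C₂ = ((4, ![2,1,1,1,1,1,1,1]) : Cls 8))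
    (h1 : IsMinusOne C₁)
    (h2 : ∀ L : Cls 8, IsMinusOne L → 0 ≤ ip C₂ L) :
    ∃ σ : Equiv.Perm (Fin 8), σ 0 = 0 ∧
      (((C₁.1, fun i => C₁.2 (σ i)), (C₂.1, fun i => C₂.2 (σ i))) :
          Cls 8 × Cls 8) ∈ sixPairs := by
  obtain ⟨a, b⟩ := C₁
  have hC2 : C₂ = (4 - a, fun i => (if i = 0 then 2 else 1) - b i) := by
    have h := eq_sub_of_add_eq' hsum
    rw [h]
    ext i
    · rfl
    · fin_cases i <;> simp <;> rfl
  subst hC2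
  clear hsum
  have hminus := h1
  simp only [IsMinusOne, ip, Kcls, Fin.sum_univ_eight] at hminus
  obtain ⟨hsq, hK⟩ := hminus
  -- reduction to a target
  have key : ∀ (u : ℤ) (S T : Finset (Fin 8)), (0 : Fin 8) ∉ S → (0 : Fin 8) ∉ T →
      S.card = T.card → (∀ i ∈ S, b i = u) → (∀ i, i ≠ 0 → i ∉ S → b i = 0) →
      (((a, fun i => if i = 0 then b 0 else if i ∈ T then u else 0),
        (4 - a, fun i => (if i = 0 then 2 else 1) -
          (if i = 0 then b 0 else if i ∈ T then u else 0))) : Cls 8 × Cls 8) ∈ sixPairs →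
      ∃ σ : Equiv.Perm (Fin 8), σ 0 = 0 ∧
      (((a, fun i => b (σ i)), (4 - a, fun i => (if σ i = 0 then 2 else 1) - b (σ i))) :
          Cls 8 × Cls 8) ∈ sixPairs := by
    intro u S T hS hT hc hb1 hb2 hmem
    obtain ⟨σ, h0, hσ⟩ := move_aux b u S T hS hT hc hb1 hb2
    refine ⟨σ, h0, ?_⟩
    have hz : ∀ i, σ i = 0 ↔ i = 0 := fun i =>
      ⟨fun hh => σ.injective (hh.trans h0.symm), fun hh => by rw [hh, h0]⟩
    simpa only [hσ, hz] using hmem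
  show ∃ σ : Equiv.Perm (Fin 8), σ 0 = 0 ∧
      (((a, fun i => b (σ i)), (4 - a, fun i => (if σ i = 0 then 2 else 1) - b (σ i))) :
          Cls 8 × Cls 8) ∈ sixPairs
  -- the number t = Q · C₁
  obtain ⟨t, ht⟩ : ∃ t, t = a - b 0 := ⟨_, rfl⟩
  have hb0 : b 0 = a - t := by omega
  have hS : b 1 + b 2 + b 3 + b 4 + b 5 + b 6 + b 7 = 2 * a - 1 + t := by linarith
  have hN : b 1 ^ 2 + b 2 ^ 2 + b 3 ^ 2 + b 4 ^ 2 + b 5 ^ 2 + b 6 ^ 2 + b 7 ^ 2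
      = 2 * a * t - t ^ 2 + 1 := by
    rw [hb0] at hsq; linarith
  have hCS : (b 1 + b 2 + b 3 + b 4 + b 5 + b 6 + b 7) ^ 2 ≤
      7 * (b 1 ^ 2 + b 2 ^ 2 + b 3 ^ 2 + b 4 ^ 2 + b 5 ^ 2 + b 6 ^ 2 + b 7 ^ 2) := by
    have := sq_sum_le_card_mul_sum_sq (s := Finset.univ) (f := fun i : Fin 7 => b i.succ)
    simpa [Fin.sum_univ_seven] using this
  rw [hS, hN] at hCS
  have ht0 : 0 ≤ t := by
    by_contra hneg
    nlinarith [sq_nonneg (8 * a - (10 * t + 4))]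
  -- L = -2K - C₁
  have ht2 : t ≤ 2 := by
    have h := h2 (6 - a, fun i => 2 - b i) (by
      simp only [IsMinusOne, ip, Kcls, Fin.sum_univ_eight]
      constructor <;> linarith)
    simp only [ip, Fin.sum_univ_eight] at h
    simp at h
    linarith
  have hle : ∀ i, i ≠ 0 → t = 2 → b i = 1 := by
    intro i hi ht2
    have hA := h2 (0, fun j => if j = i then -1 else 0) (by
      simp [IsMinusOne, ip, Kcls])
    have hB := h2 (1, fun j => if j = 0 then 1 else if j = i then 1 else 0) (by
      fin_cases i <;> simp [IsMinusOne, ip, Kcls, Fin.sum_univ_eight] at hi ⊢)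
    have hA' : b i ≤ 1 := by
      simp [ip, hi] at hA
      linarith
    have hB' : 1 ≤ b i := by
      fin_cases i <;> simp [ip, Fin.sum_univ_eight] at hB hi ⊢ <;> omega
    omega
  have ht1 : t = 0 ∨ t = 1 := by
    rcases (by omega : t = 0 ∨ t = 1 ∨ t = 2) with h | h | h
    · exact Or.inl h
    · exact Or.inr h
    · exfalso
      have e1 := hle 1 (by decide) h
      have e2 := hle 2 (by decide) h
      have e3 := hle 3 (by decide) h
      have e4 := hle 4 (by decide) h
      have e5 := hle 5 (by decide) h
      have e6 := hle 6 (by decide) h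
      have e7 := hle 7 (by decide) h
      rw [e1, e2, e3, e4, e5, e6, e7, h] at hS hN
      omega
  rcases ht1 with rfl | rfl
  · -- t = 0 : exactly one nonzero coordinate
    have hex : ∃ j, j ≠ 0 ∧ b j ≠ 0 := by
      by_contra hne
      push Not at hne
      have e := fun i hi => hne i hi
      rw [e 1 (by decide), e 2 (by decide), e 3 (by decide), e 4 (by decide), e 5 (by decide),
        e 6 (by decide), e 7 (by decide)] at hN
      omega
    obtain ⟨j, hj0, hj⟩ := hex
    have hsum7 : ∑ i ∈ Finset.univ.erase (0 : Fin 8), b i ^ 2 = 1 := by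
      have h := Finset.add_sum_erase Finset.univ (fun i => b i ^ 2) (Finset.mem_univ (0 : Fin 8))
      simp only [Fin.sum_univ_eight] at h
      linarith
    have hsumb : ∑ i ∈ Finset.univ.erase (0 : Fin 8), b i = 2 * a - 1 := by
      have h := Finset.add_sum_erase Finset.univ b (Finset.mem_univ (0 : Fin 8))
      simp only [Fin.sum_univ_eight] at h
      linarith
    have hjm : j ∈ Finset.univ.erase (0 : Fin 8) := by simp [hj0]
    have hj1 : 1 ≤ b j ^ 2 := by
      have := pow_pos (abs_pos.2 hj) 2
      rw [sq_abs] at this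
      omega
    have hother : ∀ i, i ≠ 0 → i ∉ ({j} : Finset (Fin 8)) → b i = 0 := by
      intro i hi hij
      have h := Finset.add_sum_erase _ (fun i => b i ^ 2) hjm
      simp only [hsum7] at h
      have him : i ∈ (Finset.univ.erase (0 : Fin 8)).erase j := by
        simp at hij; simp [hi, hij]
      have h' := Finset.single_le_sum (f := fun i => b i ^ 2) (fun k _ => sq_nonneg (b k)) him
      have : b i ^ 2 = 0 := le_antisymm (by linarith) (sq_nonneg _)
      exact pow_eq_zero_iff (two_ne_zero) |>.1 this
    have hbj : b j = 2 * a - 1 := by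
      rw [← hsumb]
      refine (Finset.sum_eq_single_of_mem j hjm ?_).symm
      intro i hi hij
      exact hother i (by simpa using hi) (by simpa using hij)
    have hbj2 : b j ^ 2 = 1 := by
      rw [← hsum7]
      refine (Finset.sum_eq_single_of_mem (f := fun i => b i ^ 2) j hjm ?_).symm
      intro i hi hij
      simp [hother i (by simpa using hi) (by simpa using hij)]
    have ha : a = 0 ∨ a = 1 := by
      rcases (show b j = 1 ∨ b j = -1 by simpa using hbj2) with h | h <;> omega
    rcases ha with rfl | rfl
    · refine key (-1) {j} {2} (by simpa using hj0.symm) (by decide) (by simp)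
        (by simp [hbj]) hother ?_
      rw [hb0]
      decide
    · refine key 1 {j} {1} (by simpa using hj0.symm) (by decide) (by simp)
        (by simp [hbj]) hother ?_
      rw [hb0]
      decide
  · -- t = 1 : all coordinates are 0 or 1
    have hnn : ∀ x : ℤ, 0 ≤ x ^ 2 - x := fun x => by
      rcases le_or_gt x 0 with h | h <;> nlinarith
    have h01 : ∀ i, i ≠ 0 → b i = 0 ∨ b i = 1 := by
      intro i hi
      have n1 := hnn (b 1)
      have n2 := hnn (b 2)
      have n3 := hnn (b 3)
      have n4 := hnn (b 4)
      have n5 := hnn (b 5)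
      have n6 := hnn (b 6)
      have n7 := hnn (b 7)
      have : b i ^ 2 - b i = 0 := by
        fin_cases i <;> simp at hi ⊢ <;> linarith
      have h3 : b i * (b i - 1) = 0 := by linarith
      rcases mul_eq_zero.1 h3 with h | h
      · exact Or.inl h
      · exact Or.inr (by omega)
    obtain ⟨S, hSdef⟩ : ∃ S : Finset (Fin 8), S = Finset.univ.filter (fun i => i ≠ 0 ∧ b i = 1) := ⟨_, rfl⟩
    have hcard : (S.card : ℤ) = 2 * a := by
      have h : (S.card : ℤ) = ∑ i ∈ Finset.univ.erase (0 : Fin 8), b i := by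
        rw [Finset.card_eq_sum_ones, hSdef]
        push_cast
        rw [Finset.sum_filter, ← Finset.add_sum_erase _ _ (Finset.mem_univ (0 : Fin 8))]
        simp only [ne_eq, not_true_eq_false, false_and, if_false, zero_add]
        refine Finset.sum_congr rfl fun i hi => ?_
        have hi0 : i ≠ 0 := by simpa using hi
        rcases h01 i hi0 with h | h <;> simp [hi0, h]
      have h' := Finset.add_sum_erase Finset.univ b (Finset.mem_univ (0 : Fin 8))
      simp only [Fin.sum_univ_eight] at h'
      linarith
    have hS0 : (0 : Fin 8) ∉ S := by simp [hSdef]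
    have hS7 : S.card ≤ 7 := by
      have : S ⊆ Finset.univ.erase 0 := fun i hi => by
        simp only [Finset.mem_erase, Finset.mem_univ, and_true]
        rintro rfl
        exact hS0 hi
      simpa using Finset.card_le_card this
    have hSu : ∀ i ∈ S, b i = 1 := fun i hi => by
      rw [hSdef] at hi; simp at hi; exact hi.2
    have hSz : ∀ i, i ≠ 0 → i ∉ S → b i = 0 := fun i hi hn => by
      rcases h01 i hi with h | h
      · exact h
      · exact absurd (by rw [hSdef]; simp [hi, h]) hn
    rcases (by omega : a = 0 ∨ a = 1 ∨ a = 2 ∨ a = 3) with rfl | rfl | rfl | rfl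
    · refine key 1 S ∅ hS0 (by decide) (by simp; simpa using hcard) hSu hSz ?_
      rw [hb0]; decide
    · refine key 1 S {6, 7} hS0 (by decide) (by
        rw [show ({6, 7} : Finset (Fin 8)).card = 2 from rfl]; omega) hSu hSz ?_
      rw [hb0]; decide
    · refine key 1 S {1, 2, 3, 4} hS0 (by decide) (by
        rw [show ({1, 2, 3, 4} : Finset (Fin 8)).card = 4 from rfl]; omega) hSu hSz ?_
      rw [hb0]; decide
    · refine key 1 S {1, 2, 3, 4, 5, 6} hS0 (by decide) (by
        rw [show ({1, 2, 3, 4, 5, 6} : Finset (Fin 8)).card = 6 from rfl]; omega) hSu hSz ?_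
      rw [hb0]; decide
end
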